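/- The Grigorchuk group G has intermediate growth: its growth function γ with respect to the generating set {a, b, c, d} satisfies both (ln γ(n))/(ln n) → ∞ and (ln γ(n))/n → 0 as n → ∞. -/

import Mathlib

namespace Grig

def aFun : List Bool → List Bool
  | [] => []
  | x :: v => (!x) :: v

mutual
  def bFun : List Bool → List Bool
    | [] => []
    | false :: v => false :: aFun v
    | true :: v => true :: cFun v
  def cFun : List Bool → List Bool
    | [] => []
    | false :: v => false :: aFun v
    | true :: v => true :: dFun v
  def dFun : List Bool → List Bool
    | [] => []
    | false :: v => false :: v
    | true :: v => true :: bFun v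
end

theorem aFun_invol : Function.Involutive aFun := by
  intro v; cases v <;> simp [aFun]

theorem bcd_invol : ∀ v, bFun (bFun v) = v ∧ cFun (cFun v) = v ∧ dFun (dFun v) = v := by
  intro v
  induction v with
  | nil => simp [bFun, cFun, dFun]
  | cons x v ih =>
    cases x <;> simp [bFun, cFun, dFun, aFun_invol v, ih.1, ih.2.1, ih.2.2]

/-- The automorphism `a` of the binary tree. -/
def a : Equiv.Perm (List Bool) := Function.Involutive.toPerm aFun aFun_invol

def b : Equiv.Perm (List Bool) := Function.Involutive.toPerm bFun (fun v => (bcd_invol v).1)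

def c : Equiv.Perm (List Bool) := Function.Involutive.toPerm cFun (fun v => (bcd_invol v).2.1)

def d : Equiv.Perm (List Bool) := Function.Involutive.toPerm dFun (fun v => (bcd_invol v).2.2)

/-- The Grigorchuk group, as the subgroup generated by `a, b, c, d` inside the
permutation group of the vertex set of the binary tree. -/
def grigG : Subgroup (Equiv.Perm (List Bool)) := Subgroup.closure {a, b, c, d}

end Grig

namespace Grig

/-- The growth function of the Grigorchuk group with respect to `{a, b, c, d}`: the number
of elements that are products of at most `n` elements of `{a, b, c, d}`. -/
noncomputable def grigGrowth (n : ℕ) : ℕ :=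
  Nat.card {g : Equiv.Perm (List Bool) |
    ∃ l : List (Equiv.Perm (List Bool)), l.length ≤ n ∧
      (∀ x ∈ l, x ∈ ({a, b, c, d} : Set (Equiv.Perm (List Bool)))) ∧ l.prod = g}

end Grig


namespace Grig

/-- `W wa wb wc wd n g`: `g` is a product of letters of total weight at most `n`. -/
inductive W (wa wb wc wd : ℕ) : ℕ → Equiv.Perm (List Bool) → Prop
  | one (n : ℕ) : W wa wb wc wd n 1
  | la {n m : ℕ} {g : Equiv.Perm (List Bool)} (h : W wa wb wc wd n g) (hm : n + wa ≤ m) :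
      W wa wb wc wd m (a * g)
  | lb {n m : ℕ} {g : Equiv.Perm (List Bool)} (h : W wa wb wc wd n g) (hm : n + wb ≤ m) :
      W wa wb wc wd m (b * g)
  | lc {n m : ℕ} {g : Equiv.Perm (List Bool)} (h : W wa wb wc wd n g) (hm : n + wc ≤ m) :
      W wa wb wc wd m (c * g)
  | ld {n m : ℕ} {g : Equiv.Perm (List Bool)} (h : W wa wb wc wd n g) (hm : n + wd ≤ m) :
      W wa wb wc wd m (d * g)

theorem W.mono {wa wb wc wd n m : ℕ} {g : Equiv.Perm (List Bool)} (h : W wa wb wc wd n g)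
    (hnm : n ≤ m) : W wa wb wc wd m g := by
  cases h with
  | one => exact W.one _
  | la h hm => exact W.la h (hm.trans hnm)
  | lb h hm => exact W.lb h (hm.trans hnm)
  | lc h hm => exact W.lc h (hm.trans hnm)
  | ld h hm => exact W.ld h (hm.trans hnm)

theorem W.mul {wa wb wc wd n m : ℕ} {g h : Equiv.Perm (List Bool)} (hg : W wa wb wc wd n g)
    (hh : W wa wb wc wd m h) : W wa wb wc wd (n + m) (g * h) := by
  induction hg with
  | one k => rw [one_mul]; exact hh.mono (by omega)
  | la _ hm ih => rw [mul_assoc]; exact W.la ih (by omega)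
  | lb _ hm ih => rw [mul_assoc]; exact W.lb ih (by omega)
  | lc _ hm ih => rw [mul_assoc]; exact W.lc ih (by omega)
  | ld _ hm ih => rw [mul_assoc]; exact W.ld ih (by omega)

/-- Wreath recursion: `g` acts at the root by `s` and has sections `g0`, `g1`. -/
def Sec (s : Bool) (g0 g1 g : Equiv.Perm (List Bool)) : Prop :=
  g [] = [] ∧ ∀ v, g (false :: v) = s :: g0 v ∧ g (true :: v) = (!s) :: g1 v

theorem Sec.unique {s : Bool} {g0 g1 g h : Equiv.Perm (List Bool)} (hg : Sec s g0 g1 g)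
    (hh : Sec s g0 g1 h) : g = h := by
  ext1 v
  match v with
  | [] => rw [hg.1, hh.1]
  | false :: v => rw [(hg.2 v).1, (hh.2 v).1]
  | true :: v => rw [(hg.2 v).2, (hh.2 v).2]

theorem Sec.inj {s s' : Bool} {g0 g1 h0 h1 g : Equiv.Perm (List Bool)} (hg : Sec s g0 g1 g)
    (hh : Sec s' h0 h1 g) : g0 = h0 ∧ g1 = h1 := by
  constructor
  · ext1 v
    have := (hg.2 v).1.symm.trans (hh.2 v).1
    simp at this; exact this.2
  · ext1 v
    have := (hg.2 v).2.symm.trans (hh.2 v).2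
    simp at this; exact this.2

theorem Sec.one : Sec false 1 1 1 := ⟨rfl, fun _ => ⟨rfl, rfl⟩⟩

theorem Sec.sa : Sec true 1 1 a := ⟨rfl, fun _ => ⟨rfl, rfl⟩⟩

theorem Sec.sb : Sec false a c b := by
  refine ⟨?_, fun v => ⟨?_, ?_⟩⟩ <;> simp [a, b, c, Function.Involutive.toPerm, bFun]

theorem Sec.sc : Sec false a d c := by
  refine ⟨?_, fun v => ⟨?_, ?_⟩⟩ <;> simp [a, d, c, Function.Involutive.toPerm, cFun]

theorem Sec.sd : Sec false 1 b d := by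
  refine ⟨?_, fun v => ⟨?_, ?_⟩⟩ <;> simp [b, d, Function.Involutive.toPerm, dFun]

theorem Sec.mul_false {s : Bool} {g0 g1 h0 h1 g h : Equiv.Perm (List Bool)}
    (hg : Sec s g0 g1 g) (hh : Sec false h0 h1 h) : Sec s (g0 * h0) (g1 * h1) (g * h) := by
  refine ⟨?_, fun v => ⟨?_, ?_⟩⟩ <;>
    simp [hg.1, hh.1, (hh.2 _).1, (hh.2 _).2, (hg.2 _).1, (hg.2 _).2]

theorem Sec.mul_true {s : Bool} {g0 g1 h0 h1 g h : Equiv.Perm (List Bool)}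
    (hg : Sec s g0 g1 g) (hh : Sec true h0 h1 h) : Sec (!s) (g1 * h0) (g0 * h1) (g * h) := by
  refine ⟨?_, fun v => ⟨?_, ?_⟩⟩ <;>
    simp [hg.1, hh.1, (hh.2 _).1, (hh.2 _).2, (hg.2 _).1, (hg.2 _).2]

theorem aa : a * a = 1 := by ext1 v; exact aFun_invol v
theorem bb : b * b = 1 := by ext1 v; exact (bcd_invol v).1
theorem cc : c * c = 1 := by ext1 v; exact (bcd_invol v).2.1
theorem dd : d * d = 1 := by ext1 v; exact (bcd_invol v).2.2

theorem bcd_mul : ∀ v, bFun (cFun v) = dFun v ∧ cFun (dFun v) = bFun v ∧ dFun (bFun v) = cFun v ∧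
    cFun (bFun v) = dFun v ∧ dFun (cFun v) = bFun v ∧ bFun (dFun v) = cFun v := by
  intro v
  induction v with
  | nil => simp [bFun, cFun, dFun]
  | cons x v ih =>
    obtain ⟨h1, h2, h3, h4, h5, h6⟩ := ih
    cases x <;> simp [bFun, cFun, dFun, aFun_invol v, h1, h2, h3, h4, h5, h6]

theorem bc : b * c = d := by ext1 v; exact (bcd_mul v).1
theorem cd : c * d = b := by ext1 v; exact (bcd_mul v).2.1
theorem db : d * b = c := by ext1 v; exact (bcd_mul v).2.2.1
theorem cb : c * b = d := by ext1 v; exact (bcd_mul v).2.2.2.1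
theorem dc : d * c = b := by ext1 v; exact (bcd_mul v).2.2.2.2.1
theorem bd : b * d = c := by ext1 v; exact (bcd_mul v).2.2.2.2.2

/-- Alternating products; the flag is `false` if the first letter may not be in `b, c, d`. -/
inductive Alt : Bool → ℕ → Equiv.Perm (List Bool) → Prop
  | one (s : Bool) (n : ℕ) : Alt s n 1
  | la {n m : ℕ} {g : Equiv.Perm (List Bool)} (h : Alt true n g) (hm : n + 3 ≤ m) :
      Alt false m (a * g)
  | lb {n m : ℕ} {g : Equiv.Perm (List Bool)} (h : Alt false n g) (hm : n + 3 ≤ m) :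
      Alt true m (b * g)
  | lc {n m : ℕ} {g : Equiv.Perm (List Bool)} (h : Alt false n g) (hm : n + 2 ≤ m) :
      Alt true m (c * g)
  | ld {n m : ℕ} {g : Equiv.Perm (List Bool)} (h : Alt false n g) (hm : n + 1 ≤ m) :
      Alt true m (d * g)

theorem Alt.mono {s : Bool} {n m : ℕ} {g : Equiv.Perm (List Bool)} (h : Alt s n g)
    (hnm : n ≤ m) : Alt s m g := by
  cases h with
  | one => exact Alt.one _ _
  | la h hm => exact Alt.la h (hm.trans hnm)
  | lb h hm => exact Alt.lb h (hm.trans hnm)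
  | lc h hm => exact Alt.lc h (hm.trans hnm)
  | ld h hm => exact Alt.ld h (hm.trans hnm)

theorem Alt.mul_a {s : Bool} {n m : ℕ} {g : Equiv.Perm (List Bool)} (h : Alt s n g)
    (hnm : n + 3 ≤ m) : ∃ s', Alt s' m (a * g) := by
  cases h with
  | one => exact ⟨_, Alt.la (Alt.one _ n) hnm⟩
  | la h hm => exact ⟨_, by rw [← mul_assoc, aa, one_mul]; exact h.mono (by omega)⟩
  | lb h hm => exact ⟨_, Alt.la (Alt.lb h hm) hnm⟩
  | lc h hm => exact ⟨_, Alt.la (Alt.lc h hm) hnm⟩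
  | ld h hm => exact ⟨_, Alt.la (Alt.ld h hm) hnm⟩

theorem Alt.mul_b {s : Bool} {n m : ℕ} {g : Equiv.Perm (List Bool)} (h : Alt s n g)
    (hnm : n + 3 ≤ m) : ∃ s', Alt s' m (b * g) := by
  cases h with
  | one => exact ⟨_, Alt.lb (Alt.one _ n) hnm⟩
  | la h hm => exact ⟨_, Alt.lb (Alt.la h hm) hnm⟩
  | lb h hm => exact ⟨_, by rw [← mul_assoc, bb, one_mul]; exact h.mono (by omega)⟩
  | lc h hm => exact ⟨_, by rw [← mul_assoc, bc]; exact Alt.ld h (by omega)⟩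
  | ld h hm => exact ⟨_, by rw [← mul_assoc, bd]; exact Alt.lc h (by omega)⟩

theorem Alt.mul_c {s : Bool} {n m : ℕ} {g : Equiv.Perm (List Bool)} (h : Alt s n g)
    (hnm : n + 2 ≤ m) : ∃ s', Alt s' m (c * g) := by
  cases h with
  | one => exact ⟨_, Alt.lc (Alt.one _ n) hnm⟩
  | la h hm => exact ⟨_, Alt.lc (Alt.la h hm) hnm⟩
  | lb h hm => exact ⟨_, by rw [← mul_assoc, cb]; exact Alt.ld h (by omega)⟩
  | lc h hm => exact ⟨_, by rw [← mul_assoc, cc, one_mul]; exact h.mono (by omega)⟩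
  | ld h hm => exact ⟨_, by rw [← mul_assoc, cd]; exact Alt.lb h (by omega)⟩

theorem Alt.mul_d {s : Bool} {n m : ℕ} {g : Equiv.Perm (List Bool)} (h : Alt s n g)
    (hnm : n + 1 ≤ m) : ∃ s', Alt s' m (d * g) := by
  cases h with
  | one => exact ⟨_, Alt.ld (Alt.one _ n) hnm⟩
  | la h hm => exact ⟨_, Alt.ld (Alt.la h hm) hnm⟩
  | lb h hm => exact ⟨_, by rw [← mul_assoc, db]; exact Alt.lc h (by omega)⟩
  | lc h hm => exact ⟨_, by rw [← mul_assoc, dc]; exact Alt.lb h (by omega)⟩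
  | ld h hm => exact ⟨_, by rw [← mul_assoc, dd, one_mul]; exact h.mono (by omega)⟩

theorem W.alt {n : ℕ} {g : Equiv.Perm (List Bool)} (h : W 3 3 2 1 n g) : ∃ s, Alt s n g := by
  induction h with
  | one n => exact ⟨true, Alt.one _ n⟩
  | la _ hm ih => obtain ⟨s, h⟩ := ih; exact h.mul_a hm
  | lb _ hm ih => obtain ⟨s, h⟩ := ih; exact h.mul_b hm
  | lc _ hm ih => obtain ⟨s, h⟩ := ih; exact h.mul_c hm
  | ld _ hm ih => obtain ⟨s, h⟩ := ih; exact h.mul_d hm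

theorem Alt.sec {t : Bool} {n : ℕ} {g : Equiv.Perm (List Bool)} (h : Alt t n g) :
    ∃ s g0 g1 i j, 6 * (i + j) ≤ 5 * (n + if t then 3 else 0) ∧
      W 3 3 2 1 i g0 ∧ W 3 3 2 1 j g1 ∧ Sec s g0 g1 g := by
  induction h with
  | one t n => exact ⟨false, 1, 1, 0, 0, by simp, W.one _, W.one _, Sec.one⟩
  | la _ hm ih =>
    obtain ⟨s, g0, g1, i, j, hij, h0, h1, hs⟩ := ih
    cases s
    · exact ⟨_, _, _, i, j, by simp at *; omega, h0, h1, by simpa using Sec.sa.mul_false hs⟩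
    · exact ⟨_, _, _, i, j, by simp at *; omega, h0, h1, by simpa using Sec.sa.mul_true hs⟩
  | lb _ hm ih =>
    obtain ⟨s, g0, g1, i, j, hij, h0, h1, hs⟩ := ih
    cases s
    · exact ⟨_, _, _, i + 3, j + 2, by simp at *; omega, h0.la le_rfl, h1.lc le_rfl,
        Sec.sb.mul_false hs⟩
    · exact ⟨_, _, _, i + 2, j + 3, by simp at *; omega, h0.lc le_rfl, h1.la le_rfl,
        Sec.sb.mul_true hs⟩
  | lc _ hm ih =>
    obtain ⟨s, g0, g1, i, j, hij, h0, h1, hs⟩ := ih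
    cases s
    · exact ⟨_, _, _, i + 3, j + 1, by simp at *; omega, h0.la le_rfl, h1.ld le_rfl,
        Sec.sc.mul_false hs⟩
    · exact ⟨_, _, _, i + 1, j + 3, by simp at *; omega, h0.ld le_rfl, h1.la le_rfl,
        Sec.sc.mul_true hs⟩
  | ld _ hm ih =>
    obtain ⟨s, g0, g1, i, j, hij, h0, h1, hs⟩ := ih
    cases s
    · exact ⟨_, _, _, i, j + 3, by simp at *; omega, by simpa using h0, h1.lb le_rfl,
        Sec.sd.mul_false hs⟩
    · exact ⟨_, _, _, i + 3, j, by simp at *; omega, h0.lb le_rfl, by simpa using h1,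
        Sec.sd.mul_true hs⟩

theorem W.sec {n : ℕ} {g : Equiv.Perm (List Bool)} (h : W 3 3 2 1 n g) :
    ∃ s g0 g1 i j, 6 * (i + j) ≤ 5 * (n + 3) ∧
      W 3 3 2 1 i g0 ∧ W 3 3 2 1 j g1 ∧ Sec s g0 g1 g := by
  obtain ⟨t, ht⟩ := h.alt
  obtain ⟨s, g0, g1, i, j, hij, h⟩ := ht.sec
  refine ⟨s, g0, g1, i, j, hij.trans ?_, h⟩
  cases t <;> simp

/-- Balls. -/
def Ball (wa wb wc wd n : ℕ) : Set (Equiv.Perm (List Bool)) := {g | W wa wb wc wd n g}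

theorem ball_step (wa wb wc wd n : ℕ) (ha : 0 < wa) (hb : 0 < wb) (hc : 0 < wc) (hd : 0 < wd) :
    Ball wa wb wc wd (n + 1) ⊆ {1} ∪ (a * ·) '' Ball wa wb wc wd n ∪ (b * ·) '' Ball wa wb wc wd n ∪
      (c * ·) '' Ball wa wb wc wd n ∪ (d * ·) '' Ball wa wb wc wd n := by
  intro g hg
  cases hg with
  | one => simp
  | la h hm => exact Or.inl (Or.inl (Or.inl (Or.inr ⟨_, h.mono (by omega), rfl⟩)))
  | lb h hm => exact Or.inl (Or.inl (Or.inr ⟨_, h.mono (by omega), rfl⟩))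
  | lc h hm => exact Or.inl (Or.inr ⟨_, h.mono (by omega), rfl⟩)
  | ld h hm => exact Or.inr ⟨_, h.mono (by omega), rfl⟩

theorem ball_zero (wa wb wc wd : ℕ) (ha : 0 < wa) (hb : 0 < wb) (hc : 0 < wc) (hd : 0 < wd) :
    Ball wa wb wc wd 0 = {1} := by
  ext g
  constructor
  · intro h
    cases h with
    | one => rfl
    | la h hm => omega
    | lb h hm => omega
    | lc h hm => omega
    | ld h hm => omega
  · rintro rfl; exact W.one _

theorem ball_fin (wa wb wc wd n : ℕ) (ha : 0 < wa) (hb : 0 < wb) (hc : 0 < wc) (hd : 0 < wd) :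
    (Ball wa wb wc wd n).Finite ∧ (Ball wa wb wc wd n).ncard ≤ 5 ^ n := by
  induction n with
  | zero => rw [ball_zero _ _ _ _ ha hb hc hd]; simp
  | succ n ih =>
    obtain ⟨hf, hn⟩ := ih
    have hF : ({1} ∪ (a * ·) '' Ball wa wb wc wd n ∪ (b * ·) '' Ball wa wb wc wd n ∪
      (c * ·) '' Ball wa wb wc wd n ∪ (d * ·) '' Ball wa wb wc wd n).Finite :=
      ((((Set.finite_singleton _).union (hf.image _)).union (hf.image _)).union
        (hf.image _)).union (hf.image _)
    have hs := ball_step wa wb wc wd n ha hb hc hd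
    refine ⟨hF.subset hs, (Set.ncard_le_ncard hs hF).trans ?_⟩
    have h1 : 1 ≤ 5 ^ n := Nat.one_le_pow _ _ (by norm_num)
    have ia := Set.ncard_image_le (f := (a * ·)) hf
    have ib := Set.ncard_image_le (f := (b * ·)) hf
    have ic := Set.ncard_image_le (f := (c * ·)) hf
    have id := Set.ncard_image_le (f := (d * ·)) hf
    refine (Set.ncard_union_le _ _).trans ?_
    refine (add_le_add_left (Set.ncard_union_le _ _) _).trans ?_
    refine (add_le_add_left (add_le_add_left (Set.ncard_union_le _ _) _) _).trans ?_
    refine (add_le_add_left (add_le_add_left (add_le_add_left (Set.ncard_union_le _ _) _) _) _).trans ?_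
    rw [Set.ncard_singleton, pow_succ]
    omega

theorem growth_eq (n : ℕ) : grigGrowth n = (Ball 1 1 1 1 n).ncard := by
  rw [← Nat.card_coe_set_eq]
  unfold grigGrowth
  congr 2
  ext g
  constructor
  · rintro ⟨l, hl, hx, rfl⟩
    show W 1 1 1 1 n _
    induction l generalizing n with
    | nil => exact W.one _
    | cons x l ih =>
      simp only [List.length_cons] at hl
      have := ih (n - 1) (by omega) (fun y hy => hx y (List.mem_cons_of_mem _ hy))
      rw [List.prod_cons]
      have hx' := hx x List.mem_cons_self
      rcases hx' with rfl | rfl | rfl | rfl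
      · exact this.la (by omega)
      · exact this.lb (by omega)
      · exact this.lc (by omega)
      · exact this.ld (by omega)
  · intro h
    change W 1 1 1 1 n g at h
    induction h with
    | one => exact ⟨[], by simp⟩
    | la _ hm ih => obtain ⟨l, h1, h2, rfl⟩ := ih; exact ⟨a :: l, by simp; omega, by simpa using h2, by simp⟩
    | lb _ hm ih => obtain ⟨l, h1, h2, rfl⟩ := ih; exact ⟨b :: l, by simp; omega, by simpa using h2, by simp⟩
    | lc _ hm ih => obtain ⟨l, h1, h2, rfl⟩ := ih; exact ⟨c :: l, by simp; omega, by simpa using h2, by simp⟩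
    | ld _ hm ih => obtain ⟨l, h1, h2, rfl⟩ := ih; exact ⟨d :: l, by simp; omega, by simpa using h2, by simp⟩

end Grig

namespace Grig

theorem ball_mono {wa wb wc wd n m : ℕ} (h : n ≤ m) : Ball wa wb wc wd n ⊆ Ball wa wb wc wd m :=
  fun _ hg => W.mono hg h

theorem count (n : ℕ) : (Ball 3 3 2 1 n).ncard ≤
    ∑ i ∈ Finset.range (5 * (n + 3) / 6 + 1),
      2 * ((Ball 3 3 2 1 i).ncard * (Ball 3 3 2 1 (5 * (n + 3) / 6 - i)).ncard) := by
  set m := 5 * (n + 3) / 6 with hm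
  have fin : ∀ k, (Ball 3 3 2 1 k).Finite := fun k =>
    (ball_fin 3 3 2 1 k (by norm_num) (by norm_num) (by norm_num) (by norm_num)).1
  have key : ∀ g : Equiv.Perm (List Bool), ∃ p : Bool × (Equiv.Perm (List Bool) × Equiv.Perm (List Bool)),
      g ∈ Ball 3 3 2 1 n → Sec p.1 p.2.1 p.2.2 g ∧
        ∃ i ∈ Finset.range (m + 1), p.2.1 ∈ Ball 3 3 2 1 i ∧ p.2.2 ∈ Ball 3 3 2 1 (m - i) := by
    intro g
    by_cases hg : g ∈ Ball 3 3 2 1 n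
    · obtain ⟨s, g0, g1, i, j, hij, h0, h1, hs⟩ := W.sec hg
      refine ⟨(s, g0, g1), fun _ => ⟨hs, i, ?_, h0, W.mono h1 ?_⟩⟩
      · rw [Finset.mem_range]; omega
      · omega
    · exact ⟨(true, 1, 1), fun h => absurd h hg⟩
  choose F hF using key
  let T : Set (Bool × (Equiv.Perm (List Bool) × Equiv.Perm (List Bool))) :=
    ⋃ i ∈ Finset.range (m + 1), (Set.univ : Set Bool) ×ˢ (Ball 3 3 2 1 i ×ˢ Ball 3 3 2 1 (m - i))
  have hT : T.Finite := Set.Finite.biUnion (Finset.finite_toSet _)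
    (fun i _ => Set.finite_univ.prod ((fin _).prod (fin _)))
  have h1 : (Ball 3 3 2 1 n).ncard ≤ T.ncard := by
    refine Set.ncard_le_ncard_of_injOn F ?_ ?_ hT
    · intro g hg
      obtain ⟨_, i, hi, h0, h1⟩ := hF g hg
      exact Set.mem_biUnion hi ⟨Set.mem_univ _, h0, h1⟩
    · intro g hg g' hg' h
      have e1 := (hF g hg).1
      rw [h] at e1
      exact e1.unique (hF g' hg').1
  refine h1.trans ((Finset.set_ncard_biUnion_le _ _).trans (le_of_eq ?_))
  refine Finset.sum_congr rfl fun i _ => ?_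
  rw [Set.ncard_prod, Set.ncard_prod, Set.ncard_univ, Nat.card_eq_fintype_card, Fintype.card_bool]

/-- Exponential upper bound at rate `l`. -/
def Good (l : ℝ) : Prop := ∃ C : ℝ, 0 < C ∧ ∀ n : ℕ, ((Ball 3 3 2 1 n).ncard : ℝ) ≤ C * Real.exp (l * n)

theorem good_base : Good (Real.log 5) := by
  refine ⟨1, one_pos, fun n => ?_⟩
  rw [one_mul, mul_comm, Real.exp_nat_mul, Real.exp_log (by norm_num)]
  exact_mod_cast (ball_fin 3 3 2 1 n (by norm_num) (by norm_num) (by norm_num) (by norm_num)).2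

theorem good_step {l : ℝ} (hl : 0 < l) (h : Good l) : Good (11 / 12 * l) := by
  obtain ⟨C, hC, hN⟩ := h
  refine ⟨2 * C ^ 2 * (12 / l + 4) * Real.exp (5 / 2 * l), by positivity, fun n => ?_⟩
  set m := 5 * (n + 3) / 6 with hm
  have hm1 : (m : ℝ) ≤ 5 / 6 * (n + 3) := by
    have : 6 * m ≤ 5 * (n + 3) := by omega
    have : (6 : ℝ) * m ≤ 5 * (n + 3) := by exact_mod_cast this
    linarith
  have hm2 : (m : ℝ) + 1 ≤ n + 4 := by
    have : m + 1 ≤ n + 4 := by omega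
    exact_mod_cast this
  have h1 : ((Ball 3 3 2 1 n).ncard : ℝ) ≤
      ∑ i ∈ Finset.range (m + 1), 2 * (C ^ 2 * Real.exp (l * m)) := by
    refine (Nat.cast_le.mpr (count n)).trans ?_
    push_cast
    refine Finset.sum_le_sum fun i hi => ?_
    have hi' : i ≤ m := by rw [Finset.mem_range] at hi; omega
    have e : C ^ 2 * Real.exp (l * m) = (C * Real.exp (l * i)) * (C * Real.exp (l * ((m - i : ℕ) : ℝ))) := by
      rw [Nat.cast_sub hi']
      have : l * (m : ℝ) = l * i + l * (m - i) := by ring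
      rw [this, Real.exp_add]; ring
    rw [e]
    have := hN i
    have := hN (m - i)
    gcongr
  rw [Finset.sum_const, Finset.card_range, nsmul_eq_mul] at h1
  push_cast at h1
  refine h1.trans ?_
  have h2 : (n : ℝ) + 4 ≤ (12 / l + 4) * Real.exp (l / 12 * n) := by
    have e1 := Real.add_one_le_exp (l / 12 * n)
    have e2 : (1 : ℝ) ≤ Real.exp (l / 12 * n) := Real.one_le_exp (by positivity)
    have e3 : (n : ℝ) = 12 / l * (l / 12 * n) := by field_simp
    have e4 : (n : ℝ) ≤ 12 / l * Real.exp (l / 12 * n) := by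
      conv_lhs => rw [e3]
      have : 0 < 12 / l := by positivity
      exact mul_le_mul_of_nonneg_left (by linarith) this.le
    linarith
  have h3 : Real.exp (l * m) ≤ Real.exp (5 / 2 * l) * Real.exp (5 / 6 * l * n) := by
    rw [← Real.exp_add]
    apply Real.exp_le_exp.mpr
    have := mul_le_mul_of_nonneg_left hm1 hl.le
    linarith
  have h4 : Real.exp (11 / 12 * l * n) = Real.exp (l / 12 * n) * Real.exp (5 / 6 * l * n) := by
    rw [← Real.exp_add]; congr 1; ring
  calc ((m : ℝ) + 1) * (2 * (C ^ 2 * Real.exp (l * m)))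
      ≤ ((12 / l + 4) * Real.exp (l / 12 * n)) *
        (2 * (C ^ 2 * (Real.exp (5 / 2 * l) * Real.exp (5 / 6 * l * n)))) := by
        gcongr
        linarith
    _ = _ := by rw [h4]; ring

theorem good_small {e : ℝ} (he : 0 < e) : ∃ l, 0 < l ∧ l < e ∧ Good l := by
  have h5 : 0 < Real.log 5 := Real.log_pos (by norm_num)
  have hk : ∀ k : ℕ, Good ((11 / 12) ^ k * Real.log 5) := by
    intro k
    induction k with
    | zero => simpa using good_base
    | succ k ih =>
      have := good_step (by positivity) ih
      rwa [← mul_assoc, ← pow_succ'] at this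
  obtain ⟨k, hk'⟩ := exists_pow_lt_of_lt_one (div_pos he h5) (by norm_num : (11 / 12 : ℝ) < 1)
  exact ⟨_, by positivity, by rwa [lt_div_iff₀ h5] at hk', hk k⟩

theorem ball_compare (n : ℕ) : Ball 1 1 1 1 n ⊆ Ball 3 3 2 1 (3 * n) := by
  intro g h
  change W 1 1 1 1 n g at h
  show W 3 3 2 1 (3 * n) g
  induction h with
  | one => exact W.one _
  | la _ hm ih => exact ih.la (by omega)
  | lb _ hm ih => exact ih.lb (by omega)
  | lc _ hm ih => exact ih.lc (by omega)
  | ld _ hm ih => exact ih.ld (by omega)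

theorem fin1 (n : ℕ) : (Ball 1 1 1 1 n).Finite :=
  (ball_fin 1 1 1 1 n (by norm_num) (by norm_num) (by norm_num) (by norm_num)).1

theorem fin3 (n : ℕ) : (Ball 3 3 2 1 n).Finite :=
  (ball_fin 3 3 2 1 n (by norm_num) (by norm_num) (by norm_num) (by norm_num)).1

theorem growth_pos (n : ℕ) : 0 < grigGrowth n := by
  rw [growth_eq, Set.ncard_pos (fin1 n)]
  exact ⟨1, W.one _⟩

theorem subexp : Filter.Tendsto (fun n : ℕ => Real.log (grigGrowth n) / n)
      Filter.atTop (nhds 0) := by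
  rw [Metric.tendsto_atTop]
  intro e he
  obtain ⟨l, hl, hle, C, hC, hN⟩ := good_small (show 0 < e / 6 by positivity)
  obtain ⟨M, hM⟩ := exists_nat_gt (|Real.log C| / (e / 2))
  refine ⟨M + 1, fun n hn => ?_⟩
  have hn0 : (0 : ℝ) < n := by exact_mod_cast (by omega : 0 < n)
  have hMn : (M : ℝ) < n := by exact_mod_cast (by omega : M < n)
  have hp : (1 : ℝ) ≤ grigGrowth n := by exact_mod_cast growth_pos n
  rw [Real.dist_eq, sub_zero, abs_of_nonneg (div_nonneg (Real.log_nonneg hp) hn0.le),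
    div_lt_iff₀ hn0]
  have h1 : (grigGrowth n : ℝ) ≤ C * Real.exp (l * (3 * n)) := by
    have := hN (3 * n)
    push_cast at this
    refine le_trans ?_ this
    rw [growth_eq]
    exact_mod_cast Set.ncard_le_ncard (ball_compare n) (fin3 _)
  have h2 := Real.log_le_log (by linarith) h1
  rw [Real.log_mul hC.ne' (Real.exp_pos _).ne', Real.log_exp] at h2
  have h3 : |Real.log C| < e / 2 * n := by
    rw [div_lt_iff₀ (by positivity)] at hM
    nlinarith
  have h4 := le_abs_self (Real.log C)
  have h5 : l * n < e / 6 * n := by gcongr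
  linarith

/-! Lower bound -/

/-- The finite dihedral group containing the left sections. -/
def Dset : Set (Equiv.Perm (List Bool)) :=
  {g | ∃ s g0 g1, (g0 = 1 ∨ g0 = b) ∧ (g1 = 1 ∨ g1 = b) ∧ Sec s g0 g1 g}

theorem Dset_fin : Dset.Finite := by
  have key : ∀ g : Equiv.Perm (List Bool), ∃ p : Bool × (Equiv.Perm (List Bool) × Equiv.Perm (List Bool)),
      g ∈ Dset → Sec p.1 p.2.1 p.2.2 g ∧ p ∈ (Set.univ : Set Bool) ×ˢ (({1, b} : Set (Equiv.Perm (List Bool))) ×ˢ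
        ({1, b} : Set (Equiv.Perm (List Bool)))) := by
    intro g
    by_cases hg : g ∈ Dset
    · obtain ⟨s, g0, g1, h0, h1, hs⟩ := hg
      exact ⟨(s, g0, g1), fun _ => ⟨hs, Set.mem_univ _, h0, h1⟩⟩
    · exact ⟨(true, 1, 1), fun h => absurd h hg⟩
  choose F hF using key
  refine Set.Finite.of_injOn (f := F) (t := (Set.univ : Set Bool) ×ˢ (({1, b} : Set (Equiv.Perm (List Bool))) ×ˢ
        ({1, b} : Set (Equiv.Perm (List Bool))))) ?_ ?_ ?_
  · intro g hg
    exact (hF g hg).2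
  · intro g hg g' hg' h
    have e1 := (hF g hg).1
    rw [h] at e1
    exact e1.unique (hF g' hg').1
  · exact Set.finite_univ.prod ((Set.toFinite _).prod (Set.toFinite _))

theorem Dset_one : (1 : Equiv.Perm (List Bool)) ∈ Dset :=
  ⟨false, 1, 1, Or.inl rfl, Or.inl rfl, Sec.one⟩

theorem Dset_a {g : Equiv.Perm (List Bool)} (h : g ∈ Dset) : a * g ∈ Dset := by
  obtain ⟨s, g0, g1, h0, h1, hs⟩ := h
  cases s
  · exact ⟨_, _, _, h0, h1, by simpa using Sec.sa.mul_false hs⟩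
  · exact ⟨_, _, _, h0, h1, by simpa using Sec.sa.mul_true hs⟩

theorem Dset_d {g : Equiv.Perm (List Bool)} (h : g ∈ Dset) : d * g ∈ Dset := by
  obtain ⟨s, g0, g1, h0, h1, hs⟩ := h
  cases s
  · refine ⟨_, _, _, h0, ?_, by simpa using Sec.sd.mul_false hs⟩
    rcases h1 with rfl | rfl <;> simp [bb]
  · refine ⟨_, _, _, ?_, h1, by simpa using Sec.sd.mul_true hs⟩
    rcases h0 with rfl | rfl <;> simp [bb]

theorem sec_aca : Sec false d a (a * (c * a)) := by
  simpa using Sec.sa.mul_true (Sec.sc.mul_true Sec.sa)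

theorem lift_sec {n : ℕ} {g : Equiv.Perm (List Bool)} (h : W 1 1 1 1 n g) :
    ∃ p h, p ∈ Dset ∧ W 1 1 1 1 (3 * n) h ∧ Sec false p g h := by
  induction h with
  | one => exact ⟨1, 1, Dset_one, W.one _, Sec.one⟩
  | la _ hm ih =>
    obtain ⟨p, h, hp, hw, hs⟩ := ih
    refine ⟨d * p, a * (c * (a * h)), Dset_d hp, ?_, ?_⟩
    · exact ((hw.la le_rfl).lc le_rfl).la (by omega)
    · simpa [mul_assoc] using sec_aca.mul_false hs
  | lb _ hm ih =>
    obtain ⟨p, h, hp, hw, hs⟩ := ih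
    exact ⟨p, d * h, hp, hw.ld (by omega), by simpa using Sec.sd.mul_false hs⟩
  | lc _ hm ih =>
    obtain ⟨p, h, hp, hw, hs⟩ := ih
    exact ⟨a * p, b * h, Dset_a hp, hw.lb (by omega), Sec.sb.mul_false hs⟩
  | ld _ hm ih =>
    obtain ⟨p, h, hp, hw, hs⟩ := ih
    exact ⟨a * p, c * h, Dset_a hp, hw.lc (by omega), Sec.sc.mul_false hs⟩

theorem square (n : ℕ) : grigGrowth n ^ 2 ≤ Dset.ncard ^ 2 * grigGrowth (6 * n + 2) := by
  rw [growth_eq, growth_eq]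
  have key : ∀ g : Equiv.Perm (List Bool), ∃ p h, g ∈ Ball 1 1 1 1 n → p ∈ Dset ∧
      W 1 1 1 1 (3 * n) h ∧ Sec false p g h := by
    intro g
    by_cases hg : g ∈ Ball 1 1 1 1 n
    · obtain ⟨p, h, H⟩ := lift_sec hg
      exact ⟨p, h, fun _ => H⟩
    · exact ⟨1, 1, fun h => absurd h hg⟩
  choose p h H using key
  have h1 : (Ball 1 1 1 1 n ×ˢ Ball 1 1 1 1 n).ncard ≤
      ((Dset ×ˢ Dset) ×ˢ Ball 1 1 1 1 (6 * n + 2)).ncard := by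
    refine Set.ncard_le_ncard_of_injOn
      (fun q => ((p q.1, p q.2), h q.1 * (a * (h q.2 * a)))) ?_ ?_
      ((Dset_fin.prod Dset_fin).prod (fin1 _))
    · rintro ⟨u, v⟩ ⟨hu, hv⟩
      refine ⟨⟨(H u hu).1, (H v hv).1⟩, ?_⟩
      have ha : W 1 1 1 1 1 a := by simpa using (W.one 0 : W 1 1 1 1 0 1).la (m := 1) le_rfl
      exact ((H u hu).2.1.mul (ha.mul ((H v hv).2.1.mul ha))).mono (by omega)
    · rintro ⟨u, v⟩ ⟨hu, hv⟩ ⟨u', v'⟩ ⟨hu', hv'⟩ heq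
      simp only [Prod.mk.injEq] at heq
      obtain ⟨⟨e1, e2⟩, e3⟩ := heq
      have s1 := (H u hu).2.2.mul_false (Sec.sa.mul_true ((H v hv).2.2.mul_true Sec.sa))
      have s2 := (H u' hu').2.2.mul_false (Sec.sa.mul_true ((H v' hv').2.2.mul_true Sec.sa))
      rw [e3] at s1
      obtain ⟨i1, i2⟩ := s1.inj s2
      simp only [one_mul, mul_one, e1, e2] at i1 i2
      simp only [Prod.mk.injEq]
      exact ⟨mul_right_cancel i2, mul_left_cancel i1⟩
  rw [Set.ncard_prod, Set.ncard_prod, Set.ncard_prod] at h1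
  rw [pow_two, pow_two]
  exact h1

theorem all_infinite : ¬ ({g | ∃ n, W 1 1 1 1 n g} : Set (Equiv.Perm (List Bool))).Finite := by
  intro hfin
  set S : Set (Equiv.Perm (List Bool)) := {g | ∃ n, W 1 1 1 1 n g} with hS
  have key : ∀ g : S, ∃ h : S, ∃ p, Sec false p g.1 h.1 := by
    rintro ⟨g, n, hg⟩
    obtain ⟨p, h, _, hw, hs⟩ := lift_sec hg
    exact ⟨⟨h, _, hw⟩, p, hs⟩
  choose F p hF using key
  have : Finite S := hfin
  have hinj : Function.Injective F := by
    intro x y hxy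
    have e1 := hF x
    rw [hxy] at e1
    exact Subtype.ext (e1.inj (hF y)).2
  obtain ⟨x, hx⟩ := (Finite.injective_iff_surjective.mp hinj) ⟨a, 1, by
    simpa using (W.one 0 : W 1 1 1 1 0 1).la (m := 1) le_rfl⟩
  have e1 := hF x
  rw [hx] at e1
  have e2 := (e1.2 []).1.symm.trans (Sec.sa.2 []).1
  simp at e2

theorem growth_lt (n : ℕ) : grigGrowth n < grigGrowth (n + 1) := by
  rw [growth_eq, growth_eq]
  refine Set.ncard_lt_ncard ⟨ball_mono (Nat.le_succ n), fun hsub => ?_⟩ (fin1 _)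
  refine all_infinite ((fin1 n).subset ?_)
  rintro g ⟨m, hg⟩
  induction hg with
  | one => exact W.one _
  | la _ hm ih => exact hsub (W.la ih le_rfl)
  | lb _ hm ih => exact hsub (W.lb ih le_rfl)
  | lc _ hm ih => exact hsub (W.lc ih le_rfl)
  | ld _ hm ih => exact hsub (W.ld ih le_rfl)

theorem growth_mono : Monotone grigGrowth := monotone_nat_of_le_succ fun n => (growth_lt n).le

theorem growth_ge (n : ℕ) : n ≤ grigGrowth n := by
  induction n with
  | zero => exact Nat.zero_le _
  | succ n ih => have := growth_lt n; omega

theorem poly (k : ℕ) : ∃ C : ℝ, 0 < C ∧ ∃ M : ℕ, ∀ n ≥ M, C * (n : ℝ) ^ (2 ^ k) ≤ grigGrowth n := by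
  induction k with
  | zero => exact ⟨1, one_pos, 0, fun n _ => by simpa using growth_ge n⟩
  | succ k ih =>
    obtain ⟨C, hC, M, hM⟩ := ih
    have hD : (0 : ℝ) < Dset.ncard := by
      exact_mod_cast (Set.ncard_pos Dset_fin).mpr ⟨1, Dset_one⟩
    refine ⟨(C * (1 / 12) ^ (2 ^ k)) ^ 2 / (Dset.ncard : ℝ) ^ 2, by positivity, 6 * M + 16, fun n hn => ?_⟩
    obtain ⟨q, hq⟩ : ∃ q, q = (n - 2) / 6 := ⟨_, rfl⟩
    have h1 : 6 * q + 2 ≤ n := by omega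
    have h2 : n ≤ 12 * q := by omega
    have h3 : M ≤ q := by omega
    have h4 : (1 / 12 : ℝ) * n ≤ q := by
      have : (n : ℝ) ≤ 12 * q := by exact_mod_cast h2
      linarith
    have h5 : ((grigGrowth q : ℝ)) ^ 2 ≤ (Dset.ncard : ℝ) ^ 2 * grigGrowth n := by
      exact_mod_cast (square q).trans (Nat.mul_le_mul_left _ (growth_mono h1))
    rw [div_mul_eq_mul_div, div_le_iff₀ (by positivity), mul_comm (grigGrowth n : ℝ)]
    refine le_trans ?_ h5
    calc (C * (1 / 12) ^ (2 ^ k)) ^ 2 * (n : ℝ) ^ (2 ^ (k + 1))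
        = (C * (1 / 12 * (n : ℝ)) ^ (2 ^ k)) ^ 2 := by
          rw [pow_succ 2 k, pow_mul, mul_pow (1 / 12 : ℝ)]; ring
      _ ≤ (C * (q : ℝ) ^ (2 ^ k)) ^ 2 := by gcongr
      _ ≤ (grigGrowth q : ℝ) ^ 2 := by
          have := hM q h3
          gcongr

theorem superpoly : Filter.Tendsto (fun n : ℕ => Real.log (grigGrowth n) / Real.log n)
      Filter.atTop Filter.atTop := by
  rw [Filter.tendsto_atTop]
  intro B
  obtain ⟨k, hk⟩ := pow_unbounded_of_one_lt (B + 1) (by norm_num : (1 : ℝ) < 2)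
  obtain ⟨C, hC, M, hM⟩ := poly k
  have hlog : Filter.Tendsto (fun n : ℕ => Real.log n) Filter.atTop Filter.atTop :=
    Real.tendsto_log_atTop.comp tendsto_natCast_atTop_atTop
  filter_upwards [Filter.eventually_ge_atTop M, Filter.eventually_ge_atTop 1,
    hlog.eventually_gt_atTop 0, hlog.eventually_ge_atTop (-Real.log C)] with n h1 h2 h3 h4
  rw [le_div_iff₀ h3]
  have hn : (0 : ℝ) < n := by exact_mod_cast h2
  have h5 := Real.log_le_log (by positivity) (hM n h1)
  rw [Real.log_mul hC.ne' (by positivity), Real.log_pow] at h5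
  push_cast at h5
  nlinarith

end Grig
namespace Grig

/-- **Main Theorem.** The Grigorchuk group has intermediate growth: its growth function
`γ` satisfies `ln γ(n) / ln n → ∞` (superpolynomial growth) and `ln γ(n) / n → 0`
(subexponential growth). -/
theorem grigorchuk_intermediate_growth :
    Filter.Tendsto (fun n : ℕ => Real.log (grigGrowth n) / Real.log n)
      Filter.atTop Filter.atTop ∧
    Filter.Tendsto (fun n : ℕ => Real.log (grigGrowth n) / n)
      Filter.atTop (nhds 0) := by
  exact ⟨superpoly, subexp⟩

end Grig
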